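/- Let S = ⟨Σ, S, δ, s₀, α⟩ be a nondeterministic Streett word automaton with condition α = {⟨R₁,G₁⟩, …, ⟨R_k,G_k⟩}, let J ⊆ [k], and let w ∈ Σ^ω. Suppose there exist indices 0 < i₁ < i₂ < ⋯ and nonempty subsets L₁, L₂, … of S such that: (a) every s ∈ L₁ is reachable from s₀ reading w[0, i₁−1]; and (b) for every j ≥ 1 and every s' ∈ L_{j+1} there exists s ∈ L_j such that s' is reachable from s reading w[i_j, i_{j+1}−1] along a finite run that visits R_o for every o ∈ J and contains no state of G_o for every o ∉ J. Then w ∈ L(S). -/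

import Mathlib

/-- The set of states occurring infinitely often in an infinite sequence. -/
def InfOcc {S : Type} (r : ℕ → S) : Set S :=
  {s | ∀ N : ℕ, ∃ n, N ≤ n ∧ r n = s}

/-- `r` is a run of the nondeterministic automaton with transition function `δ`
and initial state `s0` on the infinite word `w`. -/
def IsRun {A S : Type} (δ : S → A → Set S) (s0 : S) (w : ℕ → A) (r : ℕ → S) : Prop :=
  r 0 = s0 ∧ ∀ j, r (j + 1) ∈ δ (r j) (w j)

/-- The language of a nondeterministic Büchi word automaton:
some run visits the acceptance set `acc` infinitely often. -/
def BuchiLang {A S : Type} (δ : S → A → Set S) (s0 : S) (acc : Set S) : Set (ℕ → A) :=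
  {w | ∃ r, IsRun δ s0 w r ∧ (InfOcc r ∩ acc).Nonempty}

/-- The language of a nondeterministic Streett word automaton with pairs
`⟨R i, G i⟩`: some run `r` satisfies, for every `i`,
`inf(r) ∩ G i = ∅` or `inf(r) ∩ R i ≠ ∅`. -/
def StreettLang {A S : Type} {k : ℕ} (δ : S → A → Set S) (s0 : S)
    (R G : Fin k → Set S) : Set (ℕ → A) :=
  {w | ∃ r, IsRun δ s0 w r ∧ ∀ i, InfOcc r ∩ G i = ∅ ∨ (InfOcc r ∩ R i).Nonempty}

/-- The unique run of a deterministic automaton with transition function `δ`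
and initial state `s0` on the infinite word `w`. -/
def DetRun {A S : Type} (δ : S → A → S) (s0 : S) (w : ℕ → A) : ℕ → S
  | 0 => s0
  | j + 1 => δ (DetRun δ s0 w j) (w j)

/-- `F` is a partition of the state space into `k` (possibly empty) classes. -/
def IsPartition {S : Type} {k : ℕ} (F : Fin k → Set S) : Prop :=
  (∀ i j : Fin k, i ≠ j → F i ∩ F j = ∅) ∧ (⋃ i, F i) = Set.univ

/-- A run is accepted by the parity condition `F 0, …, F (k-1)` iff the least
`i` such that `inf(r) ∩ F i ≠ ∅` is even. -/
def ParityAccept {S : Type} {k : ℕ} (F : Fin k → Set S) (r : ℕ → S) : Prop :=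
  ∃ i : Fin k, Even (i : ℕ) ∧ (InfOcc r ∩ F i).Nonempty ∧
    ∀ j : Fin k, j < i → InfOcc r ∩ F j = ∅

/-- A run is accepted by the Rabin condition with pairs `⟨E i, F i⟩` iff for
some `i`, `inf(r) ∩ E i = ∅` and `inf(r) ∩ F i ≠ ∅`. -/
def RabinAccept {S : Type} {k : ℕ} (E F : Fin k → Set S) (r : ℕ → S) : Prop :=
  ∃ i : Fin k, InfOcc r ∩ E i = ∅ ∧ (InfOcc r ∩ F i).Nonempty

/-- `δ(S', σ) = ⋃_{s ∈ S'} δ(s, σ)`: one transition step applied to a set of states. -/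
def DeltaSet {A S : Type} (δ : S → A → Set S) (T : Set S) (a : A) : Set S :=
  {t | ∃ s ∈ T, t ∈ δ s a}

/-- `δ(S', u)` for a finite word `u`: `δ(S', ε) = S'` and `δ(S', uσ) = δ(δ(S', u), σ)`.
A state `t` is reachable from `s` reading `u` iff `t ∈ DeltaWord δ {s} u`. -/
def DeltaWord {A S : Type} (δ : S → A → Set S) (T : Set S) (u : List A) : Set S :=
  u.foldl (DeltaSet δ) T

/-- `r` is a finite run reading the finite word `u` (only `r 0, …, r u.length`
are relevant): consecutive states are related by the transition function. -/
def IsFinRun {A S : Type} (δ : S → A → Set S) (u : List A) (r : ℕ → S) : Prop :=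
  ∀ (j : ℕ) (h : j < u.length), r (j + 1) ∈ δ (r j) (u.get ⟨j, h⟩)

/-- A path relation on a finite type with arbitrarily long finite paths has an infinite path. -/
theorem exists_infinite_path_of_finite {S : Type} [Finite S] (E : ℕ → S → S → Prop)
    (h : ∀ n, ∃ f : ℕ → S, ∀ j < n, E j (f j) (f (j + 1))) :
    ∃ f : ℕ → S, ∀ j, E j (f j) (f (j + 1)) := by
  let _ : TopologicalSpace S := ⊥
  have _ : DiscreteTopology S := ⟨rfl⟩
  have hclosed : ∀ n, IsClosed {f : ℕ → S | ∀ j < n, E j (f j) (f (j + 1))} := by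
    intro n
    simp only [Set.ofPred_forall]
    refine isClosed_iInter fun j => isClosed_iInter fun _ => ?_
    have hc : Continuous fun f : ℕ → S => (f j, f (j + 1)) := by fun_prop
    exact (isClosed_discrete {p : S × S | E j p.1 p.2}).preimage hc
  obtain ⟨f, hf⟩ := IsCompact.nonempty_iInter_of_sequence_nonempty_isCompact_isClosed
    (fun n => {f : ℕ → S | ∀ j < n, E j (f j) (f (j + 1))})
    (fun n f hf j hj => hf j (hj.trans n.lt_succ_self)) h (hclosed 0).isCompact hclosed
  exact ⟨f, fun j => Set.mem_iInter.1 hf (j + 1) j j.lt_succ_self⟩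

/-- Backward-total relations between nonempty levels of a finite type admit an infinite path. -/
theorem exists_path_through_levels {S : Type} [Finite S] (L : ℕ → Set S)
    (hL : ∀ j, (L j).Nonempty) (E : ℕ → S → S → Prop)
    (hE : ∀ j, ∀ s' ∈ L (j + 1), ∃ s ∈ L j, E j s s') :
    ∃ f : ℕ → S, ∀ j, f j ∈ L j ∧ E j (f j) (f (j + 1)) := by
  refine exists_infinite_path_of_finite (fun j s s' => s ∈ L j ∧ E j s s') fun n => ?_
  have key : ∀ n, ∀ s ∈ L n, ∃ f : ℕ → S, f n = s ∧
      ∀ j < n, f j ∈ L j ∧ E j (f j) (f (j + 1)) := by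
    intro n
    induction n with
    | zero => exact fun s _ => ⟨fun _ => s, rfl, by simp⟩
    | succ n ih =>
      intro s' hs'
      obtain ⟨s, hs, hss'⟩ := hE n s' hs'
      obtain ⟨f, hfn, hf⟩ := ih s hs
      refine ⟨Function.update f (n + 1) s', by simp, fun j hj => ?_⟩
      rw [Function.update_of_ne (by omega)]
      rcases Nat.lt_succ_iff_lt_or_eq.1 hj with hj' | rfl
      · rw [Function.update_of_ne (by omega)]
        exact hf j hj'
      · rw [Function.update_self, hfn]
        exact ⟨hs, hss'⟩
  obtain ⟨s, hs⟩ := hL n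
  obtain ⟨f, -, hf⟩ := key n s hs
  exact ⟨f, hf⟩

/-- Finite segments with matching endpoints glue to an infinite sequence. -/
theorem exists_glue_segments {S : Type} (I : ℕ → ℕ) (hI : StrictMono I)
    (ρ : ℕ → ℕ → S) (hρ : ∀ j, ρ j (I (j + 1) - I j) = ρ (j + 1) 0) :
    ∃ r : ℕ → S, ∀ j, ∀ t ≤ I (j + 1) - I j, r (I j + t) = ρ j t := by
  let d : ℕ → ℕ := fun m => Nat.findGreatest (fun j => I j ≤ m) m
  have hd : ∀ j m, I j ≤ m → m < I (j + 1) → d m = j := by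
    intro j m h1 h2
    refine Nat.findGreatest_eq_iff.2 ⟨(hI.id_le j).trans h1, fun _ => h1, fun n hn _ => ?_⟩
    have := hI.monotone (Nat.succ_le_of_lt hn)
    simp only [Nat.succ_eq_add_one] at this
    omega
  have hlt : ∀ j, ∀ t < I (j + 1) - I j, ρ (d (I j + t)) (I j + t - I (d (I j + t))) = ρ j t := by
    intro j t ht
    rw [hd j (I j + t) (by omega) (by omega)]
    congr 1
    omega
  refine ⟨fun m => ρ (d m) (m - I (d m)), fun j t ht => ?_⟩
  rcases ht.lt_or_eq with ht | rfl
  · exact hlt j t ht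
  · have h1 := hI j.lt_succ_self
    have h2 := hI (j + 1).lt_succ_self
    have h3 := hlt (j + 1) 0 (Nat.sub_pos_of_lt h2)
    rw [add_zero] at h3
    simp only [Nat.succ_eq_add_one] at h1
    rw [Nat.add_sub_cancel' h1.le, hρ]
    exact h3

/-- A strictly increasing sequence from `0` cuts `ℕ` into half-open intervals. -/
theorem exists_segment_index (I : ℕ → ℕ) (hI0 : I 0 = 0) (hI : StrictMono I) (m : ℕ) :
    ∃ j, ∃ t < I (j + 1) - I j, m = I j + t := by
  classical
  have hex : ∃ j, m < I (j + 1) := ⟨m, (hI.id_le (m + 1))⟩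
  refine ⟨Nat.find hex, m - I (Nat.find hex), ?_⟩
  have h1 := Nat.find_spec hex
  have h2 : I (Nat.find hex) ≤ m := by
    rcases h : Nat.find hex with _ | j
    · simp [hI0]
    · exact not_lt.1 (Nat.find_min hex (h ▸ j.lt_succ_self))
  omega

theorem exists_run_of_mem_deltaWord {A S : Type} (δ : S → A → Set S) (s0 : S) (w : ℕ → A)
    (n : ℕ) (s : S) (hs : s ∈ DeltaWord δ {s0} ((List.range n).map w)) :
    ∃ r : ℕ → S, r 0 = s0 ∧ r n = s ∧ ∀ j < n, r (j + 1) ∈ δ (r j) (w j) := by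
  induction n generalizing s with
  | zero =>
    have : s = s0 := by simpa [DeltaWord] using hs
    exact ⟨fun _ => s0, rfl, this.symm, by simp⟩
  | succ n ih =>
    simp only [DeltaWord, List.range_succ, List.map_append, List.map_cons, List.map_nil,
      List.foldl_append, List.foldl_cons, List.foldl_nil] at hs
    obtain ⟨q, hq, hqs⟩ := hs
    obtain ⟨r, h0, hn, hr⟩ := ih q hq
    refine ⟨Function.update r (n + 1) s, ?_, by simp, fun j hj => ?_⟩
    · rw [Function.update_of_ne (by omega), h0]
    · rw [Function.update_of_ne (a := j) (by omega)]
      rcases Nat.lt_succ_iff_lt_or_eq.1 hj with hj' | rfl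
      · rw [Function.update_of_ne (by omega)]
        exact hr j hj'
      · rw [Function.update_self, hn]
        exact hqs

theorem infOcc_inter_nonempty {S : Type} [Finite S] (r : ℕ → S) (X : Set S)
    (h : ∀ N, ∃ n, N ≤ n ∧ r n ∈ X) : (InfOcc r ∩ X).Nonempty := by
  have hf : ∃ᶠ n in Filter.atTop, ∃ s, s ∈ X ∧ r n = s := by
    simpa [Filter.frequently_atTop] using h
  by_contra hne
  refine hf ?_
  have hev : ∀ s, ∀ᶠ n in Filter.atTop, ¬ (s ∈ X ∧ r n = s) := by
    intro s
    by_contra hs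
    have hs : ∃ᶠ n in Filter.atTop, s ∈ X ∧ r n = s := hs
    obtain ⟨hX, hr⟩ := Filter.frequently_and_distrib_left.1 hs
    exact hne ⟨s, Filter.frequently_atTop.1 hr, hX⟩
  filter_upwards [Filter.eventually_all.2 hev] with n hn
  exact fun ⟨s, hs⟩ => hn s hs

/-- Let `S` be an NSW with condition `{⟨R₁,G₁⟩,…,⟨R_k,G_k⟩}`,
let `J ⊆ [k]`, and let `w ∈ Σ^ω`.  Suppose there exist indices
`0 < i₁ < i₂ < ⋯` (given by `I j = i_{j+1}`) and nonempty subsets `L₁, L₂, …`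
of `S` (given by `L j = L_{j+1}`) such that: (a) every `s ∈ L₁` is reachable
from `s₀` reading `w[0, i₁−1]`; and (b) for every `j ≥ 1` and every
`s' ∈ L_{j+1}` there exists `s ∈ L_j` such that `s'` is reachable from `s`
reading `w[i_j, i_{j+1}−1]` along a finite run that visits `R o` for every
`o ∈ J` and contains no state of `G o` for every `o ∉ J`.  Then `w ∈ L(S)`. -/
theorem koenig_streett_accept (A : Type) [Fintype A] (S : Type) [Fintype S]
    (δ : S → A → Set S) (s0 : S) (k : ℕ) (R G : Fin k → Set S)
    (J : Set (Fin k)) (w : ℕ → A)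
    (I : ℕ → ℕ) (L : ℕ → Set S)
    (hI0 : 0 < I 0) (hImono : StrictMono I)
    (hLne : ∀ j : ℕ, (L j).Nonempty)
    (ha : ∀ s ∈ L 0, s ∈ DeltaWord δ {s0} ((List.range (I 0)).map w))
    (hb : ∀ j : ℕ, ∀ s' ∈ L (j + 1), ∃ s ∈ L j, ∃ r : ℕ → S,
      r 0 = s ∧ r (I (j + 1) - I j) = s' ∧
      IsFinRun δ ((List.range (I (j + 1) - I j)).map (fun t => w (I j + t))) r ∧
      (∀ o ∈ J, ∃ j' ≤ I (j + 1) - I j, r j' ∈ R o) ∧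
      (∀ o ∉ J, ∀ j' ≤ I (j + 1) - I j, r j' ∉ G o)) :
    w ∈ StreettLang δ s0 R G := by
  obtain ⟨f, hf⟩ := exists_path_through_levels L hLne _ hb
  choose hfL ρ hρ0 hρ1 hρrun hρR hρG using hf
  obtain ⟨ρ₀, h₀0, h₀1, h₀run⟩ := exists_run_of_mem_deltaWord δ s0 w (I 0) (f 0) (ha _ (hfL 0))
  let I' : ℕ → ℕ := fun j => Nat.casesOn j 0 I
  let ρ' : ℕ → ℕ → S := fun j => Nat.casesOn j ρ₀ ρ
  have hI' : StrictMono I' := by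
    refine strictMono_nat_of_lt_succ fun j => ?_
    cases j with
    | zero => exact hI0
    | succ j => exact hImono j.lt_succ_self
  obtain ⟨r, hr⟩ := exists_glue_segments I' hI' ρ' (by
    intro j
    cases j with
    | zero => exact h₀1.trans (hρ0 0).symm
    | succ j => exact (hρ1 j).trans (hρ0 (j + 1)).symm)
  have hrρ : ∀ j, ∀ t ≤ I (j + 1) - I j, r (I j + t) = ρ j t := fun j => hr (j + 1)
  have hstep : ∀ j, ∀ t < I' (j + 1) - I' j, ρ' j (t + 1) ∈ δ (ρ' j t) (w (I' j + t)) := by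
    intro j t ht
    cases j with
    | zero => simpa [I', ρ'] using h₀run t ht
    | succ j => simpa using hρrun j t (by simpa using ht)
  refine ⟨r, ⟨?_, fun m => ?_⟩, fun o => ?_⟩
  · exact (hr 0 0 (Nat.zero_le _)).trans h₀0
  · obtain ⟨j, t, ht, rfl⟩ := exists_segment_index I' rfl hI' m
    rw [add_assoc, hr j (t + 1) ht, hr j t ht.le]
    exact hstep j t ht
  · by_cases ho : o ∈ J
    · refine Or.inr (infOcc_inter_nonempty r _ fun N => ?_)
      obtain ⟨t, ht, htR⟩ := hρR N o ho
      exact ⟨I N + t, (hImono.id_le N).trans (Nat.le_add_right _ _), by rwa [hrρ N t ht]⟩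
    · refine Or.inl (Set.eq_empty_of_forall_notMem fun s ⟨hs, hsG⟩ => ?_)
      obtain ⟨m, hm, rfl⟩ := hs (I 0)
      obtain ⟨j, t, ht, rfl⟩ := exists_segment_index I' rfl hI' m
      cases j with
      | zero =>
        simp only [I'] at hm ht
        omega
      | succ j =>
        rw [hr (j + 1) t ht.le] at hsG
        exact hρG j o ho t ht.le hsG
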